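/- R(K₄−e, K₄−e, K₄) ≥ 33. That is, there exists an assignment of one of 3 colors to the edges of the complete graph K₃₂ such that colors 1 and 2 contain no subgraph isomorphic to K₄−e and color 3 contains no complete graph K₄. -/

import Mathlib

open SimpleGraph

/-- `G` contains a subgraph isomorphic to `H`:
there is an injective map from the vertices of `H` to those of `G` preserving adjacency. -/
def Contains {V W : Type*} (G : SimpleGraph V) (H : SimpleGraph W) : Prop :=
  ∃ f : W → V, Function.Injective f ∧ ∀ ⦃a b : W⦄, H.Adj a b → G.Adj (f a) (f b)

/-- The triangle `K₃`. -/
def triangle : SimpleGraph (Fin 3) := ⊤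

/-- The paw graph `K₃ + e`: a triangle `{0, 1, 2}` with a pendant edge `{2, 3}`. -/
def paw : SimpleGraph (Fin 4) :=
  SimpleGraph.fromEdgeSet {s(0, 1), s(0, 2), s(1, 2), s(2, 3)}

/-- `J₄ = K₄ - e`, the complete graph on 4 vertices with one edge deleted. -/
def J4 : SimpleGraph (Fin 4) := (⊤ : SimpleGraph (Fin 4)).deleteEdges {s(0, 1)}

/-- The graph formed by the edges of color `i` in the edge coloring `c` of `K_n`. -/
def colorClass {n m : ℕ} (c : Sym2 (Fin n) → Fin m) (i : Fin m) : SimpleGraph (Fin n) :=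
  SimpleGraph.fromEdgeSet {e | c e = i}

/-- A `(G1, G2, G3; n)`-coloring: a 3-coloring of the edges of `K_n` such that
color `i` contains no subgraph isomorphic to `Gi`. -/
def GoodColoring3 {a b d : ℕ} (G1 : SimpleGraph (Fin a)) (G2 : SimpleGraph (Fin b))
    (G3 : SimpleGraph (Fin d)) (n : ℕ) : Prop :=
  ∃ c : Sym2 (Fin n) → Fin 3,
    ¬ Contains (colorClass c 0) G1 ∧ ¬ Contains (colorClass c 1) G2 ∧
      ¬ Contains (colorClass c 2) G3

/-- The 3-color Ramsey number `R(G1, G2, G3)`: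
the least `n` such that no `(G1, G2, G3; n)`-coloring exists. -/
noncomputable def Ramsey3 {a b d : ℕ} (G1 : SimpleGraph (Fin a)) (G2 : SimpleGraph (Fin b))
    (G3 : SimpleGraph (Fin d)) : ℕ :=
  sInf {n : ℕ | ¬ GoodColoring3 G1 G2 G3 n}

/-- The rows of the adjacency matrix of the first color of a 3-coloring of the edges of `K₃₂`:
vertices `i` and `j` are adjacent when bit `j` of row `i` is set. The coloring is invariant under a
semiregular action of `ℤ/2 × ℤ/8` with the two orbits `{0, …, 15}` and `{16, …, 31}`. -/
def firstColorRows : List ℕ :=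
  [3275788816, 2273322272, 251742784, 503485568, 1006905601, 2013811202, 4027622404, 3776989448,
  1086525586, 2156339237, 17776714, 35553428, 71041321, 142082642, 284165284, 551618633,
  272140036, 544214792, 1088429584, 2160147488, 25393216, 34074752, 68083969, 136102658,
  940573831, 1881147407, 3762294814, 3246399548, 2197897336, 117604592, 235143649, 470287043]

/-- The rows of the adjacency matrix of the second color, encoded as in `firstColorRows`. -/
def secondColorRows : List ℕ :=
  [145031554, 273351173, 546702346, 1076693012, 2153386024, 28581968, 40452256, 80904257,
  2768798209, 1259341058, 2518682116, 759174152, 1518348304, 3019984928, 1761779776, 3523494272,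
  2197823563, 117457046, 234913837, 469762394, 939524788, 1879049321, 3758098642, 3238006949,
  8604448, 497216, 929152, 1858049, 3716098, 7366916, 14733832, 12690704]

/-- The color of the pair `i, j` in the 3-coloring of the edges of `K₃₂` given by
`firstColorRows` and `secondColorRows`. -/
def pairColor (i j : Fin 32) : Fin 3 :=
  if (firstColorRows.getD i 0).testBit j then 0
  else if (secondColorRows.getD i 0).testBit j then 1 else 2

theorem pairColor_comm : ∀ i j, pairColor i j = pairColor j i := by
  decide +kernel

theorem colorClass_adj {n m : ℕ} {c : Sym2 (Fin n) → Fin m} {i : Fin m} {u v : Fin n} :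
    (colorClass c i).Adj u v ↔ c s(u, v) = i ∧ u ≠ v := by
  simp [colorClass]

theorem J4_adj {a b : Fin 4} : J4.Adj a b ↔ a ≠ b ∧ s(a, b) ≠ s(0, 1) := by
  simp [J4]

theorem Contains.mono_right {V W : Type*} {G : SimpleGraph V} {H K : SimpleGraph W} (h : H ≤ K)
    (hG : Contains G K) : Contains G H := by
  obtain ⟨f, hf, hadj⟩ := hG
  exact ⟨f, hf, fun _ _ hab => hadj (h hab)⟩

/-- A graph containing `J4` has an edge with two distinct common neighbors of its ends. -/
theorem Contains.exists_of_J4 {V : Type*} {G : SimpleGraph V} (h : Contains G J4) :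
    ∃ x y u v, G.Adj x y ∧ G.Adj x u ∧ G.Adj y u ∧ G.Adj x v ∧ G.Adj y v ∧ u ≠ v := by
  obtain ⟨f, hf, hadj⟩ := h
  refine ⟨f 2, f 3, f 0, f 1, hadj ?_, hadj ?_, hadj ?_, hadj ?_, hadj ?_, hf.ne (by decide)⟩ <;>
    exact J4_adj.2 (by decide)

theorem pairColor_J4_free :
    ∀ k : Fin 3, k ≠ 2 → ∀ x y, pairColor x y = k → x ≠ y →
      ∀ u, pairColor x u = k → x ≠ u → pairColor y u = k → y ≠ u →
      ∀ v, pairColor x v = k → x ≠ v → pairColor y v = k → y ≠ v → u = v := by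
  decide +kernel

theorem pairColor_K4_free :
    ∀ x y, pairColor x y = 2 → x ≠ y →
      ∀ u, pairColor x u = 2 → x ≠ u → pairColor y u = 2 → y ≠ u →
      ∀ v, pairColor x v = 2 → x ≠ v → pairColor y v = 2 → y ≠ v → pairColor u v = 2 → u = v := by
  decide +kernel

/-- There is a `(J4, J4, K₄; 32)`-coloring. -/
theorem goodColoring3_J4_J4_K4_32 : GoodColoring3 J4 J4 (⊤ : SimpleGraph (Fin 4)) 32 := by
  have hJ4 (k : Fin 3) (hk : k ≠ 2) :
      ¬ Contains (colorClass (Sym2.lift ⟨pairColor, pairColor_comm⟩) k) J4 := by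
    intro h
    obtain ⟨x, y, u, v, hxy, hxu, hyu, hxv, hyv, huv⟩ := h.exists_of_J4
    simp only [colorClass_adj, Sym2.lift_mk] at hxy hxu hyu hxv hyv
    exact huv (pairColor_J4_free k hk x y hxy.1 hxy.2 u hxu.1 hxu.2 hyu.1 hyu.2 v
      hxv.1 hxv.2 hyv.1 hyv.2)
  refine ⟨Sym2.lift ⟨pairColor, pairColor_comm⟩, hJ4 0 (by decide), hJ4 1 (by decide), ?_⟩
  rintro ⟨f, hf, hadj⟩
  have h {a b : Fin 4} (hab : a ≠ b) : pairColor (f a) (f b) = 2 := by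
    have := colorClass_adj.1 (hadj ((top_adj a b).2 hab))
    simpa only [Sym2.lift_mk] using this.1
  have hne {a b : Fin 4} (hab : a ≠ b) : f a ≠ f b := hf.ne hab
  have h01 : (0 : Fin 4) ≠ 1 := by decide
  have h02 : (0 : Fin 4) ≠ 2 := by decide
  have h03 : (0 : Fin 4) ≠ 3 := by decide
  have h12 : (1 : Fin 4) ≠ 2 := by decide
  have h13 : (1 : Fin 4) ≠ 3 := by decide
  have h23 : (2 : Fin 4) ≠ 3 := by decide
  exact hne h23 (pairColor_K4_free (f 0) (f 1) (h h01) (hne h01) (f 2) (h h02) (hne h02) (h h12)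
    (hne h12) (f 3) (h h03) (hne h03) (h h13) (hne h13) (h h23))

/-- **Ramsey's theorem** for finitely many colors: every edge coloring of a sufficiently large
complete graph has, for some color `i`, a clique of size `a i` in color `i`. -/
theorem exists_monochromatic_clique {m : ℕ} (a : Fin m → ℕ) :
    ∃ N : ℕ, ∀ (V : Type) [DecidableEq V] (c : Sym2 V → Fin m) (S : Finset V), N ≤ S.card →
      ∃ i, ∃ T ⊆ S, T.card = a i ∧ ∀ u ∈ T, ∀ v ∈ T, u ≠ v → c s(u, v) = i := by
  induction hs : ∑ i, a i using Nat.strong_induction_on generalizing a with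
  | _ s ih =>
  by_cases h0 : ∃ i, a i = 0
  · obtain ⟨i, hi⟩ := h0
    exact ⟨0, fun V _ c S _ => ⟨i, ∅, by simp, by simp [hi], by simp⟩⟩
  push Not at h0
  have hlt (i : Fin m) : ∑ j, Function.update a i (a i - 1) j < s := by
    rw [← hs]
    refine Finset.sum_lt_sum (fun j _ => ?_) ⟨i, Finset.mem_univ i, ?_⟩
    · rcases eq_or_ne j i with rfl | hj
      · simp
      · simp [hj]
    · have := h0 i
      simp only [Function.update_self]
      omega
  choose N hN using fun i => ih _ (hlt i) (Function.update a i (a i - 1)) rfl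
  refine ⟨∑ i, N i + 2, fun V _ c S hS => ?_⟩
  obtain ⟨v, hv⟩ : S.Nonempty := Finset.card_pos.1 (by omega)
  obtain ⟨i, hi⟩ : ∃ i, N i ≤ {u ∈ S.erase v | c s(v, u) = i}.card := by
    by_contra! hcon
    have hcard : (S.erase v).card = ∑ i, {u ∈ S.erase v | c s(v, u) = i}.card :=
      Finset.card_eq_sum_card_fiberwise fun _ _ => Finset.mem_coe.2 (Finset.mem_univ _)
    have hle := Finset.sum_le_sum fun i (_ : i ∈ Finset.univ) => (hcon i).le
    rw [Finset.card_erase_of_mem hv] at hcard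
    omega
  obtain ⟨j, T, hTS, hTcard, hT⟩ := hN i V c _ hi
  have hTS' : T ⊆ S := fun u hu =>
    Finset.mem_of_mem_erase (Finset.mem_filter.1 (hTS hu)).1
  rcases eq_or_ne j i with rfl | hj
  · have hvT : v ∉ T := fun h => by simpa using hTS h
    have hvc (u : V) (hu : u ∈ T) : c s(v, u) = j := (Finset.mem_filter.1 (hTS hu)).2
    refine ⟨j, insert v T, Finset.insert_subset hv hTS', ?_, ?_⟩
    · have := h0 j
      rw [Finset.card_insert_of_notMem hvT, hTcard, Function.update_self]
      omega
    · intro x hx y hy hxy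
      rcases Finset.mem_insert.1 hx with rfl | hxT <;> rcases Finset.mem_insert.1 hy with rfl | hyT
      · exact absurd rfl hxy
      · exact hvc y hyT
      · rw [Sym2.eq_swap]
        exact hvc x hxT
      · exact hT x hxT y hyT hxy
  · exact ⟨j, T, hTS', by simpa [hj] using hTcard, hT⟩

theorem contains_colorClass_of_clique {n m d : ℕ} {c : Sym2 (Fin n) → Fin m} {i : Fin m}
    {T : Finset (Fin n)} (hcard : T.card = d)
    (hT : ∀ u ∈ T, ∀ v ∈ T, u ≠ v → c s(u, v) = i) :
    Contains (colorClass c i) (⊤ : SimpleGraph (Fin d)) := by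
  refine ⟨T.orderEmbOfFin hcard, (T.orderEmbOfFin hcard).injective, fun a b hab => ?_⟩
  have hne := (T.orderEmbOfFin hcard).injective.ne ((top_adj a b).1 hab)
  exact colorClass_adj.2 ⟨hT _ (T.orderEmbOfFin_mem hcard a) _ (T.orderEmbOfFin_mem hcard b) hne,
    hne⟩

theorem exists_not_goodColoring3 {a b d : ℕ} (G1 : SimpleGraph (Fin a)) (G2 : SimpleGraph (Fin b))
    (G3 : SimpleGraph (Fin d)) : ∃ n, ¬ GoodColoring3 G1 G2 G3 n := by
  obtain ⟨N, hN⟩ := exists_monochromatic_clique ![a, b, d]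
  refine ⟨N, ?_⟩
  rintro ⟨c, h1, h2, h3⟩
  obtain ⟨i, T, -, hcard, hT⟩ := hN (Fin N) c Finset.univ (by simp)
  fin_cases i
  · exact h1 ((contains_colorClass_of_clique hcard hT).mono_right le_top)
  · exact h2 ((contains_colorClass_of_clique hcard hT).mono_right le_top)
  · exact h3 ((contains_colorClass_of_clique hcard hT).mono_right le_top)

theorem GoodColoring3.of_le {a b d n k : ℕ} {G1 : SimpleGraph (Fin a)} {G2 : SimpleGraph (Fin b)}
    {G3 : SimpleGraph (Fin d)} (hkn : k ≤ n) (h : GoodColoring3 G1 G2 G3 n) :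
    GoodColoring3 G1 G2 G3 k := by
  obtain ⟨c, h1, h2, h3⟩ := h
  have key {e : ℕ} {G : SimpleGraph (Fin e)} {i : Fin 3}
      (hc : Contains (colorClass (fun p => c (p.map (Fin.castLE hkn))) i) G) :
      Contains (colorClass c i) G := by
    obtain ⟨f, hf, hadj⟩ := hc
    have hinj := (Fin.castLE_injective hkn).comp hf
    refine ⟨Fin.castLE hkn ∘ f, hinj, fun x y hxy => colorClass_adj.2 ⟨?_, hinj.ne hxy.ne⟩⟩
    exact (colorClass_adj.1 (hadj hxy)).1
  exact ⟨_, fun h => h1 (key h), fun h => h2 (key h), fun h => h3 (key h)⟩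

/-- `R(K₄-e, K₄-e, K₄) ≥ 33`: there is a 3-coloring of the edges of `K₃₂` in which
colors 1 and 2 contain no `K₄ - e` and color 3 contains no `K₄`. -/
theorem ramsey_J4_J4_K4_ge_33 :
    33 ≤ Ramsey3 J4 J4 (⊤ : SimpleGraph (Fin 4)) ∧
      GoodColoring3 J4 J4 (⊤ : SimpleGraph (Fin 4)) 32 := by
  refine ⟨le_csInf (exists_not_goodColoring3 _ _ _) fun n hn => ?_, goodColoring3_J4_J4_K4_32⟩
  by_contra! hlt
  exact hn (goodColoring3_J4_J4_K4_32.of_le (by omega))
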